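/- Let m > 0 and let A be a directly indecomposable bounded residuated lattice (⊥ ≠ ⊤ and every Boolean element equals ⊥ or ⊤) satisfying aᵐ = aᵐ⁺¹ for all a ∈ A. Then A has exactly one maximal implicative filter (i.e., A is local) if and only if for every a ∈ A, m.(aᵐ) is a Boolean element, i.e., m.(aᵐ) ∨ ¬(m.(aᵐ)) = ⊤. -/

import Mathlib

universe u

/-- A bounded (integral, commutative) residuated lattice: a bounded lattice
with a commutative monoid operation `mul` (with unit `⊤`) and a residuum
`himp` satisfying the residuation condition. -/
class BRL (α : Type u) extends Lattice α, BoundedOrder α where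
  mul : α → α → α
  himp : α → α → α
  mul_comm : ∀ a b : α, mul a b = mul b a
  mul_assoc : ∀ a b c : α, mul (mul a b) c = mul a (mul b c)
  mul_top : ∀ a : α, mul a ⊤ = a
  residuation : ∀ a b c : α, mul a b ≤ c ↔ a ≤ himp b c

namespace BRL

variable {α : Type u} [BRL α]

/-- `¬a := a → ⊥`. -/
def neg (a : α) : α := himp a ⊥

/-- `a + b := ¬(¬a · ¬b)`. -/
def add (a b : α) : α := neg (mul (neg a) (neg b))

/-- Powers: `a⁰ = ⊤`, `aⁿ⁺¹ = a · aⁿ`. -/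
def pow (a : α) : ℕ → α
  | 0 => ⊤
  | n + 1 => mul a (pow a n)

/-- Multiples: `0.a = ⊥`, `(n+1).a = a + n.a`. -/
def nmul : ℕ → α → α
  | 0, _ => ⊥
  | n + 1, a => add a (nmul n a)

/-- Implicative filter. -/
def IsFilter (F : Set α) : Prop :=
  ⊤ ∈ F ∧ (∀ a b : α, a ∈ F → a ≤ b → b ∈ F) ∧
    (∀ a b : α, a ∈ F → b ∈ F → mul a b ∈ F)

/-- The smallest implicative filter containing `S`. -/
def genFilter (S : Set α) : Set α := ⋂₀ {F : Set α | IsFilter F ∧ S ⊆ F}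

/-- Maximal (proper) implicative filter. -/
def IsMaximal (M : Set α) : Prop :=
  IsFilter M ∧ M ≠ Set.univ ∧ ∀ G : Set α, IsFilter G → M ⊂ G → G = Set.univ

/-- Prime (proper) implicative filter. -/
def IsPrime (P : Set α) : Prop :=
  IsFilter P ∧ P ≠ Set.univ ∧ ∀ a b : α, a ⊔ b ∈ P → a ∈ P ∨ b ∈ P

/-- Minimal prime implicative filter (minimal among prime implicative filters). -/
def IsMinimalPrime (P : Set α) : Prop :=
  IsPrime P ∧ ∀ Q : Set α, IsPrime Q → Q ⊆ P → Q = P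

/-- The radical: intersection of all maximal implicative filters. -/
def Rad : Set α := {a : α | ∀ M : Set α, IsMaximal M → a ∈ M}

/-- Boolean (complemented) element. -/
def Boolean (b : α) : Prop := b ⊔ neg b = ⊤

/-- Stone ultrafilter: an implicative filter generated by an ultrafilter of
the Boolean algebra of Boolean elements. -/
def IsStoneUltra (F : Set α) : Prop :=
  IsFilter F ∧ F = genFilter (F ∩ {b : α | Boolean b}) ∧ (⊥ : α) ∉ F ∧
    ∀ b : α, Boolean b → b ∈ F ∨ neg b ∈ F

lemma top_mul (a : α) : mul ⊤ a = a := by rw [mul_comm, mul_top]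

lemma mul_mono_left {a b : α} (c : α) (h : a ≤ b) : mul a c ≤ mul b c :=
  (residuation _ _ _).2 (h.trans ((residuation _ _ _).1 le_rfl))

lemma mul_mono_right {a b : α} (c : α) (h : a ≤ b) : mul c a ≤ mul c b := by
  rw [mul_comm c a, mul_comm c b]; exact mul_mono_left c h

lemma mul_le_right (a b : α) : mul a b ≤ b :=
  (mul_mono_left b le_top).trans (top_mul b).le

lemma mul_le_left (a b : α) : mul a b ≤ a := mul_comm a b ▸ mul_le_right b a

lemma mul_left_comm (a b c : α) : mul a (mul b c) = mul b (mul a c) := by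
  rw [← mul_assoc, mul_comm a b, mul_assoc]

lemma le_neg_iff (a b : α) : a ≤ neg b ↔ mul a b = ⊥ :=
  (residuation a b ⊥).symm.trans le_bot_iff

lemma le_neg_comm (a b : α) : a ≤ neg b ↔ b ≤ neg a := by
  rw [le_neg_iff, le_neg_iff, mul_comm]

lemma le_neg_neg (a : α) : a ≤ neg (neg a) := (le_neg_comm _ _).1 le_rfl

lemma neg_anti {a b : α} (h : a ≤ b) : neg b ≤ neg a :=
  (le_neg_comm _ _).1 (h.trans (le_neg_neg b))

lemma neg_neg_neg (a : α) : neg (neg (neg a)) = neg a :=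
  le_antisymm (neg_anti (le_neg_neg a)) (le_neg_neg _)

lemma neg_bot : neg (⊥ : α) = ⊤ := top_le_iff.1 ((le_neg_iff _ _).2 (top_mul _))

lemma neg_eq_top_iff (a : α) : neg a = ⊤ ↔ a = ⊥ := by
  rw [← top_le_iff, le_neg_iff, top_mul]

lemma neg_top : neg (⊤ : α) = ⊥ := by
  simpa [mul_top] using (le_neg_iff (neg (⊤ : α)) ⊤).1 le_rfl

lemma neg_mul_neg_neg (a b : α) : neg (mul a (neg (neg b))) = neg (mul a b) := by
  refine eq_of_forall_le_iff fun c => ?_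
  rw [le_neg_iff, le_neg_iff, ← mul_assoc, ← mul_assoc, ← le_neg_iff, ← le_neg_iff, neg_neg_neg]

lemma nmul_eq_neg_pow_neg (n : ℕ) (a : α) : nmul n a = neg (pow (neg a) n) := by
  induction n with
  | zero => exact neg_top.symm
  | succ n ih => rw [nmul, pow, add, ih, neg_mul_neg_neg]

lemma boolean_bot : Boolean (⊥ : α) := by simp [Boolean, neg_bot]

lemma boolean_top : Boolean (⊤ : α) := by simp [Boolean]

lemma nmul_bot (n : ℕ) : nmul n (⊥ : α) = ⊥ := by
  rw [nmul_eq_neg_pow_neg, neg_bot, ← neg_top]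
  congr 1
  induction n with
  | zero => rfl
  | succ n ih => rw [pow, ih, mul_top]

lemma pow_le {m : ℕ} (hm : 0 < m) (a : α) : pow a m ≤ a := by
  obtain ⟨n, rfl⟩ := Nat.exists_eq_succ_of_ne_zero hm.ne'
  exact mul_le_left _ _

lemma le_nmul {m : ℕ} (hm : 0 < m) (a : α) : a ≤ nmul m a := by
  rw [nmul_eq_neg_pow_neg]
  exact (le_neg_neg a).trans (neg_anti (pow_le hm _))

lemma pow_mul_self {m : ℕ} {a : α} (h : pow a m = pow a (m + 1)) :
    mul (pow a m) (pow a m) = pow a m := by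
  have key (n : ℕ) : mul (pow a n) (pow a m) = pow a m := by
    induction n with
    | zero => exact top_mul _
    | succ n ih => rw [pow, mul_assoc, ih]; exact h.symm
  exact key m

lemma IsFilter.pow_mem {F : Set α} (hF : IsFilter F) {a : α} (ha : a ∈ F) (n : ℕ) :
    pow a n ∈ F := by
  induction n with
  | zero => exact hF.1
  | succ n ih => exact hF.2.2 _ _ ha ih

lemma IsFilter.ne_univ_iff {F : Set α} (hF : IsFilter F) : F ≠ Set.univ ↔ ⊥ ∉ F := by
  rw [not_iff_not]
  exact ⟨fun h => h ▸ Set.mem_univ _,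
    fun h => Set.eq_univ_of_forall fun x => hF.2.1 _ _ h bot_le⟩

lemma IsMaximal.bot_notMem {M : Set α} (hM : IsMaximal M) : ⊥ ∉ M :=
  hM.1.ne_univ_iff.1 hM.2.1

/-- The filter generated by a filter together with an idempotent element. -/
lemma IsFilter.adjoin {F : Set α} (hF : IsFilter F) {e : α} (he : mul e e = e) :
    IsFilter {x : α | ∃ f ∈ F, mul f e ≤ x} := by
  refine ⟨⟨⊤, hF.1, le_top⟩, fun a b ⟨f, hf, h⟩ hab => ⟨f, hf, h.trans hab⟩, ?_⟩
  rintro a b ⟨f, hf, ha⟩ ⟨g, hg, hb⟩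
  refine ⟨mul f g, hF.2.2 _ _ hf hg, ?_⟩
  have h : mul (mul f g) e = mul (mul f e) (mul g e) := by
    rw [mul_assoc f e, mul_left_comm e g e, he, mul_assoc]
  rw [h]
  exact (mul_mono_left _ ha).trans (mul_mono_right _ hb)

lemma isFilter_singleton_top : IsFilter ({⊤} : Set α) := by
  refine ⟨rfl, ?_, ?_⟩
  · rintro a b rfl h
    exact top_le_iff.1 h
  · rintro a b rfl rfl
    exact mul_top _

lemma IsFilter.exists_isMaximal {F : Set α} (hF : IsFilter F) (hbot : ⊥ ∉ F) :
    ∃ M : Set α, IsMaximal M ∧ F ⊆ M := by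
  obtain ⟨M, hFM, hM⟩ := zorn_subset_nonempty {G : Set α | IsFilter G ∧ ⊥ ∉ G} (by
    intro c hc hchain ⟨G₀, hG₀⟩
    refine ⟨⋃₀ c, ⟨⟨⟨G₀, hG₀, (hc hG₀).1.1⟩, ?_, ?_⟩, ?_⟩, fun G hG =>
      Set.subset_sUnion_of_mem hG⟩
    · rintro a b ⟨G, hG, ha⟩ hab
      exact ⟨G, hG, (hc hG).1.2.1 _ _ ha hab⟩
    · rintro a b ⟨G, hG, ha⟩ ⟨H, hH, hb⟩
      rcases hchain.total hG hH with h | h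
      · exact ⟨H, hH, (hc hH).1.2.2 _ _ (h ha) hb⟩
      · exact ⟨G, hG, (hc hG).1.2.2 _ _ ha (h hb)⟩
    · rintro ⟨G, hG, hb⟩
      exact (hc hG).2 hb) F ⟨hF, hbot⟩
  refine ⟨M, ⟨hM.prop.1, hM.prop.1.ne_univ_iff.2 hM.prop.2, fun G hG hMG => ?_⟩, hFM⟩
  by_contra hne
  exact hMG.2 (hM.le_of_ge ⟨hG, hG.ne_univ_iff.1 hne⟩ hMG.1)

/-- Some maximal filter contains `a` when the idempotent power of `a` is nonzero. -/
lemma exists_isMaximal_mem {m : ℕ} (hm : 0 < m) {a : α} (h : pow a m = pow a (m + 1))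
    (hne : pow a m ≠ ⊥) : ∃ M : Set α, IsMaximal M ∧ a ∈ M := by
  obtain ⟨M, hM, hsub⟩ :=
    (isFilter_singleton_top.adjoin (pow_mul_self h)).exists_isMaximal (by
      rintro ⟨f, rfl, hf⟩
      exact hne (le_bot_iff.1 (top_mul (pow a m) ▸ hf)))
  exact ⟨M, hM, hsub ⟨⊤, rfl, (mul_le_right _ _).trans (pow_le hm a)⟩⟩

lemma IsMaximal.neg_pow_mem {M : Set α} (hM : IsMaximal M) {m : ℕ} (hm : 0 < m) {a : α}
    (h : pow a m = pow a (m + 1)) (ha : a ∉ M) : neg (pow a m) ∈ M := by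
  have huniv := hM.2.2 _ (hM.1.adjoin (pow_mul_self h))
    ⟨fun x hx => ⟨x, hx, mul_le_left _ _⟩, fun hsub =>
      ha (hsub ⟨⊤, hM.1.1, (mul_le_right _ _).trans (pow_le hm a)⟩)⟩
  obtain ⟨f, hf, hle⟩ := huniv.symm ▸ Set.mem_univ (⊥ : α)
  exact hM.1.2.1 _ _ hf ((le_neg_iff _ _).2 (le_bot_iff.1 hle))

theorem di_contractive_local_iff (m : ℕ) (hm : 0 < m)
    (hnt : (⊥ : α) ≠ ⊤) (hdi : ∀ b : α, Boolean b → b = ⊥ ∨ b = ⊤)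
    (hcon : ∀ a : α, pow a m = pow a (m + 1)) :
    (∃! M : Set α, IsMaximal M) ↔ ∀ a : α, Boolean (nmul m (pow a m)) := by
  constructor
  · rintro ⟨M, hM, huniq⟩ a
    have mem {x : α} (hx : pow x m ≠ ⊥) : x ∈ M := by
      obtain ⟨N, hN, hxN⟩ := exists_isMaximal_mem hm (hcon x) hx
      exact huniq N hN ▸ hxN
    by_cases ha : pow a m = ⊥
    · rw [ha, nmul_bot]
      exact boolean_bot
    · have hneg : pow (neg (pow a m)) m = ⊥ := by
        by_contra hne
        refine hM.bot_notMem ?_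
        rw [← (le_neg_iff (neg (pow a m)) (pow a m)).1 le_rfl]
        exact hM.1.2.2 _ _ (mem hne) (hM.1.pow_mem (mem ha) m)
      rw [nmul_eq_neg_pow_neg, hneg, neg_bot]
      exact boolean_top
  · intro hB
    obtain ⟨M, hM, -⟩ := isFilter_singleton_top.exists_isMaximal (α := α) (by simpa using hnt)
    refine ⟨M, hM, fun N hN => ?_⟩
    have hsub : M ⊆ N := by
      intro a haM
      by_contra haN
      rcases hdi _ (hB a) with h | h
      · have hbot : pow a m = ⊥ := le_bot_iff.1 (h ▸ le_nmul hm (pow a m))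
        exact hM.bot_notMem (hbot ▸ hM.1.pow_mem haM m)
      · rw [nmul_eq_neg_pow_neg, neg_eq_top_iff] at h
        exact hN.bot_notMem (h ▸ hN.1.pow_mem (hN.neg_pow_mem hm (hcon a) haN) m)
    by_contra hne
    exact hN.2.1 (hM.2.2 N hN.1 (hsub.ssubset_of_ne (Ne.symm hne)))

end BRL
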